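/- Let N = 31 · 37 · 101 · 103 · 109 · 199 · 419 · 449 · 521 · 571 · 911 · 2089 · 2551 · 5851 · 11969. Then N is composite and squarefree, and for every prime p dividing N, p² − 1 divides N − 1. Consequently N is a rigid Carmichael number of order 2; in particular, the map x ↦ x^N is a ring endomorphism of every commutative Z/NZ-algebra that can be generated as a Z/NZ-module by 2 elements. -/

import Mathlib

theorem pow_eq_self_of_dvd_sub_one {M : Type*} [Monoid M] {w : M} {q n : ℕ} (hq : 0 < q)
    (hn : 0 < n) (hdvd : q - 1 ∣ n - 1) (hw : w ^ q = w) : w ^ n = w := by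
  obtain ⟨k, hk⟩ := hdvd
  obtain rfl : n = (q - 1) * k + 1 := by omega
  clear hk hn
  induction k with
  | zero => simp
  | succ k ih =>
    rw [show (q - 1) * (k + 1) + 1 = (q - 1) * k + 1 + (q - 1) by ring, pow_add, ih,
      ← pow_succ', Nat.sub_add_cancel hq, hw]

theorem IsNilpotent.pow_finrank_eq_zero {K A : Type*} [Field K] [CommRing A] [Algebra K A]
    [Module.Finite K A] {z : A} (hz : IsNilpotent z) : z ^ Module.finrank K A = 0 := by
  have h := LinearMap.aeval_self_charpoly (Algebra.lmul K A z)
  rw [IsNilpotent.charpoly_eq_X_pow_finrank (hz.map (Algebra.lmul K A)), map_pow,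
    Polynomial.aeval_X, ← map_pow] at h
  simpa using LinearMap.congr_fun h 1

section RankTwo

variable {p : ℕ} [Fact p.Prime] {B : Type*} [CommRing B] [Algebra (ZMod p) B]
  [Module.Finite (ZMod p) B]

theorem pow_prime_sq_eq_self_of_isDomain [IsDomain B] (hB : Module.finrank (ZMod p) B ≤ 2)
    (x : B) : x ^ p ^ 2 = x := by
  classical
  have : Finite B := Module.finite_of_finite (ZMod p)
  have := Fintype.ofFinite B
  let _ : Field B := Fintype.fieldOfDomain B
  have hcard : Fintype.card B = p ^ Module.finrank (ZMod p) B := by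
    simpa using Module.card_eq_pow_finrank (K := ZMod p) (V := B)
  have hx := FiniteField.pow_card x
  have hpos : 0 < Module.finrank (ZMod p) B := Module.finrank_pos
  obtain h | h : Module.finrank (ZMod p) B = 1 ∨ Module.finrank (ZMod p) B = 2 := by omega
  · rw [hcard, h, pow_one] at hx
    rw [pow_two, pow_mul, hx, hx]
  · rwa [hcard, h] at hx

theorem isNilpotent_pow_prime_sq_sub_self (hB : Module.finrank (ZMod p) B ≤ 2) (x : B) :
    IsNilpotent (x ^ p ^ 2 - x) := by
  rw [nilpotent_iff_mem_prime]
  intro P hP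
  rw [← Ideal.Quotient.eq_zero_iff_mem, map_sub, map_pow, sub_eq_zero]
  refine pow_prime_sq_eq_self_of_isDomain (p := p) (le_trans ?_ hB) _
  exact LinearMap.finrank_le_finrank_of_surjective
    (f := (Ideal.Quotient.mkₐ (ZMod p) P).toLinearMap) Ideal.Quotient.mk_surjective

theorem pow_eq_pow_prime_sq (hB : Module.finrank (ZMod p) B ≤ 2) {n : ℕ} (hn : 0 < n)
    (hpn : p ∣ n) (hdvd : p ^ 2 - 1 ∣ n - 1) (x : B) : x ^ n = x ^ p ^ 2 := by
  nontriviality B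
  have hp : p.Prime := Fact.out
  have : CharP B p := charP_of_injective_algebraMap (algebraMap (ZMod p) B).injective p
  have hx : (x ^ p ^ 2) ^ p = x ^ p := by
    rw [← sub_eq_zero, ← sub_pow_char]
    exact pow_eq_zero_of_le (hB.trans hp.two_le)
      (isNilpotent_pow_prime_sq_sub_self hB x).pow_finrank_eq_zero
  have hw : (x ^ p ^ 2) ^ p ^ 2 = x ^ p ^ 2 := by
    rw [pow_two p, pow_mul, ← pow_two, hx, ← pow_mul, ← pow_two]
  obtain ⟨m, rfl⟩ := hpn
  rw [pow_mul, ← hx, ← pow_mul]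
  exact pow_eq_self_of_dvd_sub_one (pow_pos hp.pos 2) hn hdvd hw

theorem add_pow_of_finrank_le_two (hB : Module.finrank (ZMod p) B ≤ 2) {n : ℕ} (hn : 0 < n)
    (hpn : p ∣ n) (hdvd : p ^ 2 - 1 ∣ n - 1) (x y : B) : (x + y) ^ n = x ^ n + y ^ n := by
  nontriviality B
  have : CharP B p := charP_of_injective_algebraMap (algebraMap (ZMod p) B).injective p
  simp only [pow_eq_pow_prime_sq hB hn hpn hdvd, add_pow_char_pow]

end RankTwo

section ZModAlgebra

variable {n : ℕ} {A : Type*} [CommRing A] [Algebra (ZMod n) A]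

theorem span_image_eq_top_of_surjective [NeZero n] {p : ℕ} {B : Type*} [CommRing B]
    [Algebra (ZMod p) B] {f : A →+* B} (hf : Function.Surjective f) {s : Set A}
    (hs : Submodule.span (ZMod n) s = ⊤) : Submodule.span (ZMod p) (f '' s) = ⊤ := by
  rw [eq_top_iff]
  rintro b -
  obtain ⟨a, rfl⟩ := hf b
  have ha : a ∈ Submodule.span (ZMod n) s := hs ▸ Submodule.mem_top
  induction ha using Submodule.span_induction with
  | mem x hx => exact Submodule.subset_span (Set.mem_image_of_mem f hx)
  | zero => simp
  | add x y _ _ hx hy => simpa using add_mem hx hy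
  | smul c x _ hx =>
    rw [← ZMod.natCast_zmod_val c, Nat.cast_smul_eq_nsmul, map_nsmul]
    exact nsmul_mem hx _

theorem natCast_dvd_add_pow_sub (hn : 0 < n) {s : Finset A} (hcard : s.card ≤ 2)
    (hs : Submodule.span (ZMod n) (s : Set A) = ⊤) {p : ℕ} (hp : p.Prime) (hpn : p ∣ n)
    (hdvd : p ^ 2 - 1 ∣ n - 1) (x y : A) :
    (p : A) ∣ (x + y) ^ n - (x ^ n + y ^ n) := by
  classical
  have : Fact p.Prime := ⟨hp⟩
  have : NeZero n := ⟨hn.ne'⟩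
  let π := Ideal.Quotient.mk (Ideal.span {(p : A)})
  rw [← Ideal.mem_span_singleton, ← Ideal.Quotient.eq_zero_iff_mem]
  obtain _ | _ := subsingleton_or_nontrivial (A ⧸ Ideal.span {(p : A)})
  · exact Subsingleton.elim _ _
  have hchar : CharP (A ⧸ Ideal.span {(p : A)}) p := by
    rw [CharP.charP_iff_prime_eq_zero hp, ← map_natCast π, Ideal.Quotient.eq_zero_iff_mem]
    exact Ideal.mem_span_singleton_self _
  let _ : Algebra (ZMod p) (A ⧸ Ideal.span {(p : A)}) := ZMod.algebra _ p
  have htop : Submodule.span (ZMod p) (s.image π : Set (A ⧸ Ideal.span {(p : A)})) = ⊤ := by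
    rw [Finset.coe_image]
    exact span_image_eq_top_of_surjective Ideal.Quotient.mk_surjective hs
  have : Module.Finite (ZMod p) (A ⧸ Ideal.span {(p : A)}) := ⟨⟨_, htop⟩⟩
  have hrank : Module.finrank (ZMod p) (A ⧸ Ideal.span {(p : A)}) ≤ 2 := by
    rw [← finrank_top, ← htop]
    exact (finrank_span_finset_le_card _).trans (Finset.card_image_le.trans hcard)
  simp only [map_sub, map_add, map_pow, sub_eq_zero]
  exact add_pow_of_finrank_le_two hrank hn hpn hdvd _ _

theorem add_pow_of_span_card_le_two (hn : Squarefree n)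
    (hdvd : ∀ p : ℕ, p.Prime → p ∣ n → p ^ 2 - 1 ∣ n - 1) {s : Finset A} (hcard : s.card ≤ 2)
    (hs : Submodule.span (ZMod n) (s : Set A) = ⊤) (x y : A) :
    (x + y) ^ n = x ^ n + y ^ n := by
  have hprod : ∏ p ∈ n.primeFactors, (p : A) ∣ (x + y) ^ n - (x ^ n + y ^ n) := by
    refine Finset.prod_dvd_of_coprime (fun p hp q hq hpq => ?_) fun p hp => ?_
    · exact ((Nat.coprime_primes (Nat.prime_of_mem_primeFactors hp)
        (Nat.prime_of_mem_primeFactors hq)).2 hpq).cast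
    · have hp' := Nat.prime_of_mem_primeFactors hp
      have hpn := Nat.dvd_of_mem_primeFactors hp
      exact natCast_dvd_add_pow_sub (Nat.pos_of_ne_zero hn.ne_zero) hcard hs hp' hpn
        (hdvd p hp' hpn) x y
  rw [← Nat.cast_prod, Nat.prod_primeFactors_of_squarefree hn,
    ← map_natCast (algebraMap (ZMod n) A), ZMod.natCast_self, map_zero, zero_dvd_iff] at hprod
  exact sub_eq_zero.1 hprod

end ZModAlgebra

/-- The number `N = 31·37·101·103·109·199·419·449·521·571·911·2089·2551·5851·11969` (from the search in Section 4) is a squarefree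
composite number with `p² − 1 ∣ N − 1` for every prime `p ∣ N`; consequently it is a
rigid Carmichael number of order 2, and in particular `x ↦ x^N` is a ring endomorphism
of every commutative `ZMod N`-algebra generated as a `ZMod N`-module by 2 elements. -/
theorem stmt_15 :
    let N : ℕ := 31 * 37 * 101 * 103 * 109 * 199 * 419 * 449 * 521 * 571 * 911 * 2089 * 2551 * 5851 * 11969
    1 < N ∧ ¬ N.Prime ∧ Squarefree N ∧
      (∀ p : ℕ, p.Prime → p ∣ N → p ^ 2 - 1 ∣ N - 1) ∧
      (∀ (A : Type) [CommRing A] [Algebra (ZMod N) A],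
        (∃ s : Finset A, s.card ≤ 2 ∧ Submodule.span (ZMod N) (s : Set A) = ⊤) →
        ∀ x y : A, (x + y) ^ N = x ^ N + y ^ N) := by
  intro N
  have hperm : [31, 37, 101, 103, 109, 199, 419, 449, 521, 571, 911, 2089, 2551, 5851,
      11969].Perm N.primeFactorsList :=
    Nat.primeFactorsList_unique (by norm_num [N]) (by norm_num)
  have hsq : Squarefree N := by
    rw [Nat.squarefree_iff_nodup_primeFactorsList (by norm_num [N]), ← hperm.nodup_iff]
    decide
  have hdvd : ∀ p : ℕ, p.Prime → p ∣ N → p ^ 2 - 1 ∣ N - 1 := by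
    intro p hp hpN
    have hmem := hperm.mem_iff.2 ((Nat.mem_primeFactorsList (by norm_num [N])).2 ⟨hp, hpN⟩)
    clear hp hpN
    revert p
    norm_num [N]
  refine ⟨by norm_num [N], ?_, hsq, hdvd, ?_⟩
  · exact Nat.not_prime_of_dvd_of_lt (m := 31) (by norm_num [N]) (by norm_num) (by norm_num [N])
  · rintro A _ _ ⟨s, hcard, hs⟩ x y
    exact add_pow_of_span_card_le_two hsq hdvd hcard hs x y
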